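/- For every integer g ≥ 3, the symplectic group Sp(2g, ℤ) is perfect: its commutator subgroup equals the whole group. -/

import Mathlib

open Matrix
open scoped commutatorElement

namespace SymplecticGroup

section CommRing

variable {l R : Type*} [DecidableEq l] [Fintype l] [CommRing R]

/-- The upper block unipotent symplectic matrix attached to a symmetric matrix. -/
def upper (S : Matrix l l R) (hS : S.IsSymm) : symplecticGroup l R :=
  ⟨fromBlocks 1 S 0 1, by simp [fromBlocks_mem_iff, hS.eq]⟩

/-- The lower block unipotent symplectic matrix attached to a symmetric matrix. -/
def lower (S : Matrix l l R) (hS : S.IsSymm) : symplecticGroup l R :=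
  ⟨fromBlocks 1 0 S 1, by simp [fromBlocks_mem_iff, hS.eq]⟩

/-- The block diagonal symplectic matrix attached to an invertible matrix `A` with inverse `B`. -/
def levi (A B : Matrix l l R) (h : B * A = 1) : symplecticGroup l R :=
  ⟨fromBlocks A 0 0 Bᵀ, by simp [fromBlocks_mem_iff, ← transpose_mul, h]⟩

theorem upper_add (S S' : Matrix l l R) (hS : S.IsSymm) (hS' : S'.IsSymm) :
    upper (S + S') (hS.add hS') = upper S hS * upper S' hS' :=
  Subtype.ext <| by simp [upper, fromBlocks_multiply, add_comm]

theorem levi_mul_upper {A B S : Matrix l l R} (h : B * A = 1) (hS : S.IsSymm)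
    (hS' : (A * S * Aᵀ).IsSymm) :
    levi A B h * upper S hS = upper (A * S * Aᵀ) hS' * levi A B h :=
  Subtype.ext <| by
    simp [levi, upper, fromBlocks_multiply, Matrix.mul_assoc, ← transpose_mul, h]

theorem symJ_mul_upper_neg {S : Matrix l l R} (hS : S.IsSymm) :
    symJ l R * upper (-S) hS.neg = lower S hS * symJ l R :=
  Subtype.ext <| by simp [lower, upper, J, fromBlocks_multiply]

/-- The symmetric matrices whose upper unipotent lies in a given subgroup. -/
def upperParameters (H : Subgroup (symplecticGroup l R)) : AddSubgroup (Matrix l l R) where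
  carrier := {S | ∃ hS : S.IsSymm, upper S hS ∈ H}
  zero_mem' := ⟨isSymm_zero, by
    convert H.one_mem
    exact Subtype.ext (by simp [upper])⟩
  add_mem' := by
    rintro S S' ⟨hS, h⟩ ⟨hS', h'⟩
    exact ⟨hS.add hS', by rw [upper_add _ _ hS hS']; exact H.mul_mem h h'⟩
  neg_mem' := by
    rintro S ⟨hS, h⟩
    refine ⟨hS.neg, ?_⟩
    convert H.inv_mem h
    rw [eq_inv_iff_mul_eq_one]
    exact Subtype.ext (by simp [upper, fromBlocks_multiply])

theorem conj_sub_mem_upperParameters {A B S : Matrix l l R} (h : B * A = 1) (hS : S.IsSymm) :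
    A * S * Aᵀ - S ∈ upperParameters (commutator (symplecticGroup l R)) := by
  have hS' : (A * S * Aᵀ).IsSymm := by
    simp [IsSymm, transpose_mul, hS.eq, Matrix.mul_assoc]
  refine ⟨hS'.sub hS, ?_⟩
  have key : upper (A * S * Aᵀ - S) (hS'.sub hS) = ⁅levi A B h, upper S hS⁆ := by
    rw [commutatorElement_def, levi_mul_upper h hS hS', mul_inv_cancel_right,
      eq_mul_inv_iff_mul_eq, ← upper_add]
    exact Subtype.ext (by simp [upper])
  rw [key]
  exact Subgroup.commutator_mem_commutator (Subgroup.mem_top _) (Subgroup.mem_top _)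

theorem transvection_conj_sub_mem {i j : l} (hij : i ≠ j) {S : Matrix l l R} (hS : S.IsSymm) :
    transvection i j 1 * S * (transvection i j 1)ᵀ - S ∈
      upperParameters (commutator (symplecticGroup l R)) :=
  conj_sub_mem_upperParameters (B := transvection i j (-1))
    (by rw [transvection_mul_transvection_same _ _ hij]; simp) hS

theorem single_add_single_mem {i j k : l} (hij : i ≠ j) (hjk : j ≠ k) :
    single i k 1 + single k i 1 ∈ upperParameters (commutator (symplecticGroup l R)) := by
  have hS : (single j k (1 : R) + single k j 1).IsSymm := by simp [IsSymm, add_comm]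
  convert transvection_conj_sub_mem hij hS using 1
  simp [transvection, transpose_add, add_mul, mul_add, hjk, hjk.symm]
  abel

theorem single_diag_mem {i j k : l} (hij : i ≠ j) (hik : i ≠ k) (hjk : j ≠ k) :
    single i i 1 ∈ upperParameters (commutator (symplecticGroup l R)) := by
  have hS : (single j j (1 : R)).IsSymm := by simp [IsSymm]
  have h := sub_mem (transvection_conj_sub_mem hij hS)
    (single_add_single_mem (R := R) hik hjk.symm)
  convert h using 1
  simp [transvection, transpose_add, add_mul, mul_add]
  abel

theorem lower_mem_of_upper_mem {H : Subgroup (symplecticGroup l R)} [H.Normal]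
    (hU : ∀ (S : Matrix l l R) (hS : S.IsSymm), upper S hS ∈ H)
    (S : Matrix l l R) (hS : S.IsSymm) : lower S hS ∈ H := by
  have h := Subgroup.Normal.conj_mem ‹H.Normal› _ (hU (-S) hS.neg) (symJ l R)
  rwa [symJ_mul_upper_neg, mul_inv_cancel_right] at h

theorem upper_mem_commutator {g : ℕ} (hg : 3 ≤ g) (S : Matrix (Fin g) (Fin g) ℤ)
    (hS : S.IsSymm) : upper S hS ∈ commutator (symplecticGroup (Fin g) ℤ) := by
  have hex (i k : Fin g) : ∃ j, j ≠ i ∧ j ≠ k := by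
    obtain ⟨j, -, hj⟩ := Finset.exists_mem_notMem_of_card_lt_card
      (s := {i, k}) (t := (Finset.univ : Finset (Fin g)))
      (Finset.card_le_two.trans_lt (by rw [Finset.card_univ, Fintype.card_fin]; omega))
    exact ⟨j, by simpa using hj⟩
  have hoff {i k : Fin g} : single i k 1 + single k i 1 ∈
      upperParameters (commutator (symplecticGroup (Fin g) ℤ)) := by
    obtain ⟨j, hji, hjk⟩ := hex i k
    exact single_add_single_mem hji.symm hjk
  have hdiag {i : Fin g} : single i i 1 ∈
      upperParameters (commutator (symplecticGroup (Fin g) ℤ)) := by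
    obtain ⟨j, hji, -⟩ := hex i i
    obtain ⟨k, hki, hkj⟩ := hex i j
    exact single_diag_mem hji.symm hki.symm hkj.symm
  have hsum : S = ∑ i, ∑ j, if i < j then S i j • (single i j 1 + single j i 1) else
      if i = j then S i i • single i i 1 else 0 := by
    ext a b
    have hentry (i j : Fin g) : (if i < j then S i j • (single i j 1 + single j i 1) else
        if i = j then S i i • single i i 1 else 0 : Matrix (Fin g) (Fin g) ℤ) a b =
        if i = min a b then if j = max a b then S a b else 0 else 0 := by
      have := hS.apply a b
      split_ifs <;> simp [single_apply] <;> grind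
    simp only [Matrix.sum_apply, hentry]
    simp
  have hmem : S ∈ upperParameters (commutator (symplecticGroup (Fin g) ℤ)) := by
    rw [hsum]
    refine sum_mem fun i _ => sum_mem fun j _ => ?_
    split_ifs
    · exact zsmul_mem hoff _
    · exact zsmul_mem hdiag _
    · exact zero_mem _
  exact hmem.2

theorem col_dotProduct_J_mulVec_col (M : symplecticGroup l R) (p q : l ⊕ l) :
    M.1.col p ⬝ᵥ J l R *ᵥ M.1.col q = J l R p q := by
  have h := congrFun₂ (mem_iff'.1 M.2) p q
  rw [Matrix.mul_assoc, Matrix.mul_apply] at h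
  exact h

end CommRing

end SymplecticGroup

theorem exists_isSymm_mulVec_eq {l R : Type*} [DecidableEq l] [Fintype l] [CommRing R]
    {x : l → R} {j : l} (hx : x j * x j = 1) (z : l → R) :
    ∃ S : Matrix l l R, S.IsSymm ∧ S *ᵥ x = z ∧ ∀ i, i ≠ j → z i = 0 → ∀ a, S i a = 0 := by
  refine ⟨x j • (vecMulVec (Pi.single j 1) z + vecMulVec z (Pi.single j 1)) -
    (z ⬝ᵥ x) • vecMulVec (Pi.single j 1) (Pi.single j 1), ?_, ?_, ?_⟩
  · simp [IsSymm, transpose_vecMulVec, add_comm]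
  · ext a
    simp [sub_mulVec, smul_mulVec, add_mulVec, vecMulVec_mulVec]
    linear_combination z a * hx
  · intro i hij hi a
    simp [hij, hi, vecMulVec_apply]

theorem exists_isSymm_mulVec_apply {l R : Type*} [DecidableEq l] [Fintype l] [CommRing R]
    (i j : l) (c : R) :
    ∃ S : Matrix l l R, S.IsSymm ∧ (∀ x, (S *ᵥ x) i = c * x j) ∧
      (∀ a, a ≠ i → a ≠ j → ∀ b, S a b = 0) := by
  refine ⟨.of fun a b => if (a = i ∧ b = j) ∨ (a = j ∧ b = i) then c else 0, ?_, ?_, ?_⟩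
  · ext a b
    simp only [transpose_apply, of_apply]
    grind
  · intro x
    rw [mulVec, dotProduct, Finset.sum_eq_single j]
    · simp
    · intro b _ hb
      rw [of_apply, if_neg (by grind), zero_mul]
    · simp
  · intro a hi hj b
    simp [hi, hj]

/-- A property of pairs of integer vectors that is stable under the moves `x ↦ x + S y` and
`y ↦ y + S x`, and all of whose instances are primitive, holds for a basis vector. -/
theorem reduce_to_single {l : Type*} [DecidableEq l] [Fintype l] {T : Finset l} {k : l}
    (hk : k ∉ T) {P : (l → ℤ) → (l → ℤ) → Prop}
    (hU : ∀ x y, P x y → ∀ S : Matrix l l ℤ, S.IsSymm → P (x + S *ᵥ y) y)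
    (hL : ∀ x y, P x y → ∀ S : Matrix l l ℤ, S.IsSymm → (∀ i ∈ T, ∀ j, S i j = 0) →
      P x (y + S *ᵥ x))
    (hT : ∀ x y, P x y → ∀ i ∈ T, y i = 0)
    (hprim : ∀ x y, P x y → ∀ d : ℤ, (∀ i ∉ T, d ∣ x i) → (∀ i, d ∣ y i) → IsUnit d)
    {x y : l → ℤ} (hP : P x y) : P (Pi.single k 1) 0 := by
  have solveU {x y} (h : P x y) {j} (hj : y j * y j = 1) (z) : P z y := by
    obtain ⟨S, hS, hSy, -⟩ := exists_isSymm_mulVec_eq hj (z - x)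
    simpa [hSy] using hU x y h S hS
  have solveL {x y} (h : P x y) {j} (hjT : j ∉ T) (hj : x j * x j = 1) (z)
      (hz : ∀ i ∈ T, z i = 0) : P x z := by
    obtain ⟨S, hS, hSx, hS0⟩ := exists_isSymm_mulVec_eq hj (z - y)
    have := hL x y h S hS fun i hi => hS0 i (by grind) (by simp [hz i hi, hT x y h i hi])
    simpa [hSx] using this
  have moveU {x y} (h : P x y) (i j) (c : ℤ) : ∃ x', P x' y ∧ x' i = x i + c * y j := by
    obtain ⟨S, hS, hSy, -⟩ := exists_isSymm_mulVec_apply i j c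
    exact ⟨_, hU x y h S hS, by simp [hSy]⟩
  have moveL {x y} (h : P x y) {i j} (hi : i ∉ T) (hj : j ∉ T) (c : ℤ) :
      ∃ y', P x y' ∧ y' i = y i + c * x j := by
    obtain ⟨S, hS, hSx, hS0⟩ := exists_isSymm_mulVec_apply i j c
    exact ⟨_, hL x y h S hS fun a ha => hS0 a (by grind) (by grind), by simp [hSx]⟩
  have hunit : ∃ x y, P x y ∧ ((∃ j ∉ T, x j * x j = 1) ∨ ∃ j, y j * y j = 1) := by
    let Q (n : ℕ) : Prop := 0 < n ∧ ∃ x y, P x y ∧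
      ((∃ j ∉ T, (x j).natAbs = n) ∨ ∃ j, (y j).natAbs = n)
    have hQ : ∃ n, Q n := by
      by_contra! hQ
      refine not_isUnit_zero (hprim x y hP 0 (fun i hi => ?_) fun i => ?_)
      · by_contra hne
        exact hQ _ ⟨Int.natAbs_pos.2 (by simpa using hne), x, y, hP, .inl ⟨i, hi, rfl⟩⟩
      · by_contra hne
        exact hQ _ ⟨Int.natAbs_pos.2 (by simpa using hne), x, y, hP, .inr ⟨i, rfl⟩⟩
    classical
    obtain ⟨n, ⟨hn, x, y, h, hxy⟩, hmin⟩ :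
        ∃ n, Q n ∧ ∀ m < n, ¬ Q m := ⟨Nat.find hQ, Nat.find_spec hQ, fun _ => Nat.find_min hQ⟩
    have divL {x y} (h : P x y) {j} (hj : j ∉ T) (hx : (x j).natAbs = n) (i) : (n : ℤ) ∣ y i := by
      by_cases hi : i ∈ T
      · simp [hT x y h i hi]
      obtain ⟨y', h', hy'⟩ := moveL h hi hj (-(y i / x j))
      have hmod : y' i = y i % x j := by rw [hy', Int.emod_def]; ring
      rw [← hx, Int.natAbs_dvd]
      refine Int.dvd_of_emod_eq_zero ?_
      by_contra hne
      have hlt := Int.emod_lt_abs (y i) (b := x j) (by omega)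
      have hnn := Int.emod_nonneg (y i) (b := x j) (by omega)
      rw [Int.abs_eq_natAbs, hx] at hlt
      exact hmin (y' i).natAbs (by omega) ⟨by omega, x, y', h', .inr ⟨i, rfl⟩⟩
    have divU {x y} (h : P x y) {j} (hy : (y j).natAbs = n) (i) (hi : i ∉ T) :
        (n : ℤ) ∣ x i := by
      obtain ⟨x', h', hx'⟩ := moveU h i j (-(x i / y j))
      have hmod : x' i = x i % y j := by rw [hx', Int.emod_def]; ring
      rw [← hy, Int.natAbs_dvd]
      refine Int.dvd_of_emod_eq_zero ?_
      by_contra hne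
      have hlt := Int.emod_lt_abs (x i) (b := y j) (by omega)
      have hnn := Int.emod_nonneg (x i) (b := y j) (by omega)
      rw [Int.abs_eq_natAbs, hy] at hlt
      exact hmin (x' i).natAbs (by omega) ⟨by omega, x', y, h', .inl ⟨i, hi, rfl⟩⟩
    have hn1 : IsUnit (n : ℤ) := by
      obtain ⟨j, hj, hx⟩ | ⟨j, hy⟩ := hxy
      · obtain ⟨c, hc⟩ : x j ∣ n - y j :=
          Int.natAbs_dvd.1 (by rw [hx]; exact dvd_sub_self_left.2 (divL h hj hx j))
        obtain ⟨y', h', hy'⟩ := moveL h hj hj c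
        have hy'n : (y' j).natAbs = n := by
          rw [hy', mul_comm, ← hc]; simp
        exact hprim x y h n (divU h' hy'n) (divL h hj hx)
      · have hj : j ∉ T := fun hj => by simp [hT x y h j hj] at hy; omega
        obtain ⟨c, hc⟩ : y j ∣ n - x j :=
          Int.natAbs_dvd.1 (by rw [hy]; exact dvd_sub_self_left.2 (divU h hy j hj))
        obtain ⟨x', h', hx'⟩ := moveU h j j c
        have hx'n : (x' j).natAbs = n := by
          rw [hx', mul_comm, ← hc]; simp
        exact hprim x y h n (divU h hy) (divL h' hj hx'n)
    have hn1' : n = 1 := by simpa [Int.isUnit_iff_natAbs_eq] using hn1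
    have sq {a : ℤ} (ha : a.natAbs = n) : a * a = 1 := by
      rw [← Int.natAbs_mul_self, ha, hn1']; rfl
    exact ⟨x, y, h, hxy.imp (fun ⟨j, hj, hx⟩ => ⟨j, hj, sq hx⟩) fun ⟨j, hy⟩ => ⟨j, sq hy⟩⟩
  have hfin {x y} (h : P x y) {j} (hj : y j * y j = 1) : P (Pi.single k 1) 0 :=
    solveL (solveU h hj (Pi.single k 1)) hk (by simp) 0 (by simp)
  obtain ⟨x, y, h, ⟨j, hjT, hj⟩ | ⟨j, hj⟩⟩ := hunit
  · exact hfin (solveL h hjT hj (Pi.single k 1) fun i hi => by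
      simp [show i ≠ k by grind]) (j := k) (by simp)
  · exact hfin h hj

namespace SymplecticGroup

variable {l : Type*} [DecidableEq l] [Fintype l]

theorem exists_mul_col_eq_single {H : Subgroup (symplecticGroup l ℤ)}
    (hU : ∀ S hS, upper S hS ∈ H) (hL : ∀ S hS, lower S hS ∈ H) (M : symplecticGroup l ℤ)
    (T : Finset l) : ∃ h ∈ H, ∀ i ∈ T, (h * M).1.col (.inl i) = Sum.elim (Pi.single i 1) 0 := by
  induction T using Finset.induction_on with
  | empty => exact ⟨1, H.one_mem, by simp⟩
  | insert k T hk ih =>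
    let P (x y : l → ℤ) : Prop := ∃ h ∈ H,
      (∀ i ∈ T, (h * M).1.col (.inl i) = Sum.elim (Pi.single i 1) 0) ∧
      (h * M).1.col (.inl k) = Sum.elim x y
    suffices P (Pi.single k 1) 0 by
      obtain ⟨h, hH, hT, hk⟩ := this
      exact ⟨h, hH, Finset.forall_mem_insert .. |>.2 ⟨hk, hT⟩⟩
    have hcol (A B : symplecticGroup l ℤ) (p) : (A * B).1.col p = A.1 *ᵥ B.1.col p := rfl
    obtain ⟨h, hH, hT⟩ := ih
    refine reduce_to_single (P := P) hk ?_ ?_ ?_ ?_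
      ⟨h, hH, hT, (Sum.elim_comp_inl_inr _).symm⟩
    · rintro x y ⟨h, hH, hT, hxy⟩ S hS
      refine ⟨upper S hS * h, H.mul_mem (hU S hS) hH, fun i hi => ?_, ?_⟩
      · rw [mul_assoc, hcol, hT i hi]
        ext (a | a) <;> simp [upper, one_apply, Pi.single_apply]
      · rw [mul_assoc, hcol, hxy]
        simp [upper, fromBlocks_mulVec]
    · rintro x y ⟨h, hH, hT, hxy⟩ S hS hST
      refine ⟨lower S hS * h, H.mul_mem (hL S hS) hH, fun i hi => ?_, ?_⟩
      · rw [mul_assoc, hcol, hT i hi]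
        have hSi (a : l) : S a i = 0 := hS.apply i a ▸ hST i hi a
        ext (a | a) <;> simp [lower, one_apply, Pi.single_apply, hSi]
      · rw [mul_assoc, hcol, hxy]
        simp [lower, fromBlocks_mulVec, add_comm]
    · rintro x y ⟨h, hH, hT, hxy⟩ i hi
      have := col_dotProduct_J_mulVec_col (h * M) (.inl i) (.inl k)
      rw [hT i hi, hxy] at this
      simpa [J, fromBlocks_mulVec, neg_mulVec] using this
    · rintro x y ⟨h, hH, hT, hxy⟩ d hdx hdy
      obtain ⟨u, w, huw⟩ : ∃ u w, (h * M).1.col (.inr k) = Sum.elim u w :=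
        ⟨_, _, (Sum.elim_comp_inl_inr _).symm⟩
      have hw (i) (hi : i ∈ T) : w i = 0 := by
        have := col_dotProduct_J_mulVec_col (h * M) (.inl i) (.inr k)
        rw [hT i hi, huw] at this
        simpa [J, fromBlocks_mulVec, neg_mulVec, one_apply, show i ≠ k by grind] using this
      have hone := col_dotProduct_J_mulVec_col (h * M) (.inl k) (.inr k)
      rw [hxy, huw] at hone
      simp only [J, fromBlocks_mulVec, Sum.elim_comp_inl, Sum.elim_comp_inr, zero_mulVec, zero_add,
        add_zero, neg_mulVec, one_mulVec, sumElim_dotProduct_sumElim, dotProduct_neg,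
        fromBlocks_apply₁₂, Matrix.neg_apply, one_apply_eq] at hone
      have hx : d ∣ x ⬝ᵥ w := Finset.dvd_sum fun i _ => by
        by_cases hi : i ∈ T
        · simp [hw i hi]
        · exact (hdx i hi).mul_right _
      have hy : d ∣ y ⬝ᵥ u := Finset.dvd_sum fun i _ => (hdy i).mul_right _
      have hdvd : d ∣ 1 := by
        rw [show (1 : ℤ) = x ⬝ᵥ w - y ⬝ᵥ u by linarith]
        exact dvd_sub hx hy
      exact isUnit_of_dvd_one hdvd

theorem eq_top_of_upper_mem_of_lower_mem {H : Subgroup (symplecticGroup l ℤ)}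
    (hU : ∀ S hS, upper S hS ∈ H) (hL : ∀ S hS, lower S hS ∈ H) : H = ⊤ := by
  rw [Subgroup.eq_top_iff']
  intro M
  obtain ⟨h, hH, hcol⟩ := exists_mul_col_eq_single hU hL M Finset.univ
  rw [← H.mul_mem_cancel_left hH]
  obtain ⟨A, B, C, D, hN⟩ : ∃ A B C D, (h * M).1 = fromBlocks A B C D :=
    ⟨_, _, _, _, (fromBlocks_toBlocks _).symm⟩
  have hA : A = 1 := by
    ext a i
    have := congrFun (hcol i (Finset.mem_univ i)) (.inl a)
    simpa [hN, one_apply, Pi.single_apply] using this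
  have hC : C = 0 := by
    ext a i
    have := congrFun (hcol i (Finset.mem_univ i)) (.inr a)
    simpa [hN] using this
  subst hA hC
  obtain ⟨-, hBD, hD⟩ := fromBlocks_mem_iff.1 (hN ▸ (h * M).2)
  obtain rfl : D = 1 := by simpa using hD
  have hB : B.IsSymm := by simpa [IsSymm] using hBD
  have : h * M = upper B hB := Subtype.ext hN
  exact this ▸ hU B hB

end SymplecticGroup

/-- For every integer `g ≥ 3`, the symplectic group `Sp(2g, ℤ)` is perfect:
its commutator subgroup equals the whole group. -/
theorem sp_perfect (g : ℕ) (hg : 3 ≤ g) :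
    commutator (Matrix.symplecticGroup (Fin g) ℤ) = ⊤ := by
  have hU := SymplecticGroup.upper_mem_commutator hg
  exact SymplecticGroup.eq_top_of_upper_mem_of_lower_mem hU
    (SymplecticGroup.lower_mem_of_upper_mem hU)
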